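/- Let A be a J-algebra and a, b ∈ A with a˘;a ≤ 1', b˘;b ≤ 1', 1 = a˘;b, 1 = a;1 = b;1, and (a;a˘)·(b;b˘) ≤ 1'. Define A₁ = a;a˘;a˘ · b;a;b˘;a˘ · b;b;b˘ and B₁ = a;a˘ · b;a;a˘;a˘;b˘ · b;b;a;b˘;a˘;b˘ · b;b;b;b˘;b˘. Then the two defining relations of Thompson's group F hold: (A₁;B₁;A₁˘);(B₁˘;A₁) = (B₁˘;A₁);(A₁;B₁;A₁˘) and (A₁;A₁;B₁;A₁˘;A₁˘);(B₁˘;A₁) = (B₁˘;A₁);(A₁;A₁;B₁;A₁˘;A₁˘). -/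

import Mathlib

/-- A J-algebra: an algebra (A, ·, 0, 1, ;, ˘, 1') satisfying Jónsson's axioms. -/
structure JAlgebra (A : Type*) where
  meet : A → A → A        -- Boolean product ·
  comp : A → A → A        -- relative product ;
  conv : A → A            -- converse ˘
  zero : A                -- 0
  one : A                 -- 1
  ident : A               -- 1'
  massoc : ∀ x y z, meet x (meet y z) = meet (meet x y) z
  mcomm : ∀ x y, meet x y = meet y x
  midem : ∀ x, meet x x = x
  cassoc : ∀ x y z, comp x (comp y z) = comp (comp x y) z
  cid : ∀ x, comp x ident = x
  semidist : ∀ x y z, comp (meet x y) z = meet (comp (meet x y) z) (comp y z)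
  convconv : ∀ x, conv (conv x) = x
  convcomp : ∀ x y, conv (comp x y) = comp (conv y) (conv x)
  convmeet : ∀ x y, conv (meet x y) = meet (conv x) (conv y)
  rot : ∀ x y z, meet (comp x y) z =
    meet (comp (meet (comp z (conv y)) x) (meet y (comp (conv x) z))) z
  zbot : ∀ x, meet zero x = zero
  otop : ∀ x, meet x one = x
  comp_zero : ∀ x, comp x zero = zero

/-- x ≤ y iff x·y = x. -/
def JAlgebra.le {A : Type*} (J : JAlgebra A) (x y : A) : Prop := J.meet x y = x

/-- x is functional iff x˘;x ≤ 1'. -/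
def JAlgebra.Functional {A : Type*} (J : JAlgebra A) (x : A) : Prop :=
  J.le (J.comp (J.conv x) x) J.ident

/-- x is permutational iff x;x˘ = 1' = x˘;x. -/
def JAlgebra.Permutational {A : Type*} (J : JAlgebra A) (x : A) : Prop :=
  J.comp x (J.conv x) = J.ident ∧ J.comp (J.conv x) x = J.ident

section PairingMonoid

variable {M : Type*} [Monoid M] {a b : M} {p : M → M → M}

/-- In a monoid with jointly monic projections `a`, `b` and pairing `p`, the reassociation
`A = ⟨⟨a, ba⟩, bb⟩` and its shifted version `B`, with inverses `A'` and `B'`, satisfy the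
relations of Thompson's group `F`. -/
theorem thompson_relations_of_pairing (hpa : ∀ f g, p f g * a = f) (hpb : ∀ f g, p f g * b = g)
    (ext : ∀ f g, f * a = g * a → f * b = g * b → f = g) {A A' B B' : M}
    (hA : A = p (p a (b * a)) (b * b)) (hA' : A' = p (a * a) (p (a * b) b))
    (hB : B = p a (p (p (b * a) (b * (b * a))) (b * (b * b))))
    (hB' : B' = p a (p (b * (a * a)) (p (b * (a * b)) (b * b)))) :
    A * B * A' * (B' * A) = B' * A * (A * B * A') ∧
      A * A * B * A' * A' * (B' * A) = B' * A * (A * A * B * A' * A') := by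
  have hpa' : ∀ f g h, p f g * (a * h) = f * h := fun f g h => by rw [← mul_assoc, hpa]
  have hpb' : ∀ f g h, p f g * (b * h) = g * h := fun f g h => by rw [← mul_assoc, hpb]
  have hmul : ∀ h f g, h * p f g = p (h * f) (h * g) := fun h f g =>
    ext _ _ (by rw [mul_assoc, hpa, hpa]) (by rw [mul_assoc, hpb, hpb])
  subst hA hA' hB hB'
  constructor <;> simp only [mul_assoc, hpa, hpb, hpa', hpb', hmul]

end PairingMonoid

namespace JAlgebra

variable {A : Type*} (J : JAlgebra A) {x y z w f g a b : A}

theorem le_refl (x : A) : J.le x x := J.midem x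

variable {J}

theorem le_trans (h : J.le x y) (k : J.le y z) : J.le x z := by
  unfold le at *
  rw [← h, ← J.massoc, k]

theorem le_antisymm (h : J.le x y) (k : J.le y x) : x = y := by
  unfold le at *
  rw [← h, J.mcomm, k]

theorem meet_le_right : J.le (J.meet x y) y := by
  unfold le
  rw [← J.massoc, J.midem]

theorem meet_le_left : J.le (J.meet x y) x := J.mcomm y x ▸ meet_le_right

theorem le_meet (h : J.le x y) (k : J.le x z) : J.le x (J.meet y z) := by
  unfold le at *
  rw [J.massoc, h, k]

theorem le_one : J.le x J.one := J.otop x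

theorem conv_mono (h : J.le x y) : J.le (J.conv x) (J.conv y) := by
  unfold le at *
  rw [← J.convmeet, h]

theorem comp_mono_left (h : J.le x y) : J.le (J.comp x z) (J.comp y z) := by
  have := J.semidist x y z
  rw [h] at this
  exact this.symm

theorem comp_mono_right (h : J.le x y) : J.le (J.comp z x) (J.comp z y) := by
  have := conv_mono (comp_mono_left (z := J.conv z) (conv_mono h))
  simpa only [J.convcomp, J.convconv] using this

theorem comp_mono (h : J.le x y) (k : J.le z w) : J.le (J.comp x z) (J.comp y w) :=
  le_trans (comp_mono_left h) (comp_mono_right k)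

theorem conv_ident : J.conv J.ident = J.ident := by
  have := J.convcomp (J.conv J.ident) J.ident
  rw [J.cid, J.convconv, J.cid] at this
  exact this.symm

theorem ident_comp (x : A) : J.comp J.ident x = x := by
  have := J.convcomp (J.conv x) J.ident
  rw [J.cid, J.convconv, conv_ident] at this
  exact this.symm

theorem comp_le_left (h : J.le x J.ident) : J.le (J.comp y x) y := by
  simpa only [J.cid] using comp_mono_right (z := y) h

theorem comp_le_right (h : J.le x J.ident) : J.le (J.comp x y) y := by
  simpa only [ident_comp] using comp_mono_left (z := y) h

theorem conv_one : J.conv J.one = J.one :=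
  by
  have h := conv_mono (le_one (J := J) (x := J.conv J.one))
  rw [J.convconv] at h
  exact le_antisymm le_one h

/-- A one-sided form of the modular law. -/
theorem modular_left : J.le (J.meet (J.comp x y) z) (J.comp (J.meet (J.comp z (J.conv y)) x) y) := by
  rw [J.rot]
  exact le_trans meet_le_left (comp_mono_right meet_le_left)

theorem meet_comp_conv (hf : J.Functional f) (x y : A) :
    J.comp (J.meet x y) (J.conv f) = J.meet (J.comp x (J.conv f)) (J.comp y (J.conv f)) := by
  refine le_antisymm (le_meet (comp_mono_left meet_le_left) (comp_mono_left meet_le_right)) ?_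
  refine le_trans modular_left (comp_mono_left (le_meet meet_le_right ?_))
  refine le_trans meet_le_left ?_
  rw [J.convconv, ← J.cassoc]
  exact comp_le_left hf

variable (J) in
/-- A map is a functional element with full domain. -/
structure IsMap (f : A) : Prop where
  functional : J.Functional f
  total : J.comp f J.one = J.one

namespace IsMap

theorem ident_le (hf : J.IsMap f) : J.le J.ident (J.comp f (J.conv f)) := by
  have h := J.rot f J.one J.ident
  rw [hf.total, J.mcomm, J.otop, J.cid] at h
  rw [h]
  exact le_trans meet_le_left (comp_mono meet_le_right meet_le_right)

theorem ident : J.IsMap J.ident where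
  functional := by
    unfold Functional
    rw [J.cid, conv_ident]
    exact J.le_refl _
  total := ident_comp _

theorem comp (hf : J.IsMap f) (hg : J.IsMap g) : J.IsMap (J.comp f g) where
  functional := by
    unfold Functional
    rw [J.convcomp, ← J.cassoc, J.cassoc _ f g]
    exact le_trans (comp_mono_right (comp_le_right hf.functional)) hg.functional
  total := by rw [← J.cassoc, hg.total, hf.total]

theorem eq_of_le (hf : J.IsMap f) (hg : J.IsMap g) (h : J.le f g) : f = g := by
  refine le_antisymm h ?_
  have h₁ : J.le g (J.comp (J.comp f (J.conv f)) g) := by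
    simpa only [ident_comp] using comp_mono_left (z := g) hf.ident_le
  refine le_trans h₁ ?_
  rw [← J.cassoc]
  have h₂ : J.le (J.comp (J.conv f) g) J.ident :=
    le_trans (comp_mono_left (conv_mono h)) hg.functional
  exact comp_le_left h₂

end IsMap

variable (J) in
/-- The pairing of `f` and `g` with respect to the projections `a` and `b`. -/
def pair (a b f g : A) : A := J.meet (J.comp f (J.conv a)) (J.comp g (J.conv b))

theorem pair_swap : J.pair a b f g = J.pair b a g f := J.mcomm _ _

theorem pair_comp_fst (ha : J.IsMap a) (hg : J.IsMap g)
    (hQ : J.one = J.comp (J.conv b) a) : J.comp (J.pair a b f g) a = f := by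
  unfold pair
  apply le_antisymm
  · refine le_trans (comp_mono_left meet_le_left) ?_
    rw [← J.cassoc]
    exact comp_le_left ha.functional
  · have h := modular_left (J := J) (x := J.comp g (J.conv b)) (y := a) (z := f)
    rwa [← J.cassoc, ← hQ, hg.total, J.mcomm, J.otop] at h

theorem one_eq_conv_comp_symm (hQ : J.one = J.comp (J.conv a) b) :
    J.one = J.comp (J.conv b) a := by
  rw [← J.convconv a, ← J.convcomp, ← hQ, conv_one]

theorem pair_comp_snd (hb : J.IsMap b) (hf : J.IsMap f)
    (hQ : J.one = J.comp (J.conv a) b) : J.comp (J.pair a b f g) b = g := by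
  rw [pair_swap, pair_comp_fst hb hf hQ]

theorem functional_pair_aux (hf : J.IsMap f) (h : J.le x (J.comp f (J.conv a))) :
    J.le (J.comp (J.conv x) x) (J.comp a (J.conv a)) := by
  refine le_trans (comp_mono (conv_mono h) h) ?_
  rw [J.convcomp, J.convconv, ← J.cassoc, J.cassoc _ f]
  exact comp_mono_right (comp_le_right hf.functional)

theorem IsMap.pair (ha : J.IsMap a) (hQ : J.one = J.comp (J.conv a) b)
    (hU : J.le (J.meet (J.comp a (J.conv a)) (J.comp b (J.conv b))) J.ident)
    (hf : J.IsMap f) (hg : J.IsMap g) : J.IsMap (J.pair a b f g) where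
  functional := le_trans (le_meet (functional_pair_aux hf meet_le_left)
    (functional_pair_aux hg meet_le_right)) hU
  total := by
    refine le_antisymm le_one ?_
    have h := comp_mono_right (J := J) (z := J.pair a b f g) (le_one (x := J.comp a J.one))
    rwa [J.cassoc, pair_comp_fst ha hg (one_eq_conv_comp_symm hQ), hf.total] at h

theorem le_comp_conv (ha : J.IsMap a) : J.le f (J.comp (J.comp f a) (J.conv a)) := by
  rw [← J.cassoc]
  simpa only [J.cid] using comp_mono_right (z := f) ha.ident_le

/-- The monoid of maps, with composition in diagrammatic order. -/
@[reducible]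
def mapMonoid (J : JAlgebra A) : Monoid {f // J.IsMap f} where
  mul f g := ⟨J.comp f.1 g.1, f.2.comp g.2⟩
  one := ⟨J.ident, IsMap.ident⟩
  mul_assoc f g h := Subtype.ext (J.cassoc _ _ _).symm
  one_mul f := Subtype.ext (ident_comp _)
  mul_one f := Subtype.ext (J.cid _)

end JAlgebra

open JAlgebra in
/-- Under (Q), (D), (U), the elements A₁ and B₁ satisfy the two defining
relations of Thompson's group F. -/
theorem thompson_F_relations {A : Type*} (J : JAlgebra A) (a b : A)
    (ha : J.le (J.comp (J.conv a) a) J.ident)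
    (hb : J.le (J.comp (J.conv b) b) J.ident)
    (hQ : J.one = J.comp (J.conv a) b)
    (hDa : J.one = J.comp a J.one)
    (hDb : J.one = J.comp b J.one)
    (hU : J.le (J.meet (J.comp a (J.conv a)) (J.comp b (J.conv b))) J.ident)
    (A₁ B₁ : A)
    (hA₁ : A₁ = J.meet (J.meet (J.comp (J.comp a (J.conv a)) (J.conv a))
                  (J.comp (J.comp (J.comp b a) (J.conv b)) (J.conv a)))
                (J.comp (J.comp b b) (J.conv b)))
    (hB₁ : B₁ = J.meet (J.meet (J.meet (J.comp a (J.conv a))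
                  (J.comp (J.comp (J.comp (J.comp b a) (J.conv a)) (J.conv a)) (J.conv b)))
                  (J.comp (J.comp (J.comp (J.comp (J.comp b b) a) (J.conv b)) (J.conv a)) (J.conv b)))
                (J.comp (J.comp (J.comp (J.comp b b) b) (J.conv b)) (J.conv b))) :
    J.comp (J.comp (J.comp A₁ B₁) (J.conv A₁)) (J.comp (J.conv B₁) A₁) =
      J.comp (J.comp (J.conv B₁) A₁) (J.comp (J.comp A₁ B₁) (J.conv A₁)) ∧
    J.comp (J.comp (J.comp (J.comp (J.comp A₁ A₁) B₁) (J.conv A₁)) (J.conv A₁))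
        (J.comp (J.conv B₁) A₁) =
      J.comp (J.comp (J.conv B₁) A₁)
        (J.comp (J.comp (J.comp (J.comp A₁ A₁) B₁) (J.conv A₁)) (J.conv A₁)) := by
  have ma : J.IsMap a := ⟨ha, hDa.symm⟩
  have mb : J.IsMap b := ⟨hb, hDb.symm⟩
  have hQ' := one_eq_conv_comp_symm hQ
  let := J.mapMonoid
  let p : {f // J.IsMap f} → {f // J.IsMap f} → {f // J.IsMap f} :=
    fun f g => ⟨J.pair a b f.1 g.1, ma.pair hQ hU f.2 g.2⟩
  let α : {f // J.IsMap f} := ⟨a, ma⟩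
  let β : {f // J.IsMap f} := ⟨b, mb⟩
  have eq_pair : ∀ f : {f // J.IsMap f}, f = p (f * α) (f * β) := fun f =>
    Subtype.ext (f.2.eq_of_le (p (f * α) (f * β)).2 (le_meet (le_comp_conv ma) (le_comp_conv mb)))
  have h := thompson_relations_of_pairing (a := α) (b := β) (p := p)
    (fun f g => Subtype.ext (pair_comp_fst ma g.2 hQ'))
    (fun f g => Subtype.ext (pair_comp_snd mb f.2 hQ))
    (fun f g h k => by rw [eq_pair f, eq_pair g, h, k]) rfl rfl rfl rfl
  have hA : (p (p α (β * α)) (β * β)).1 = A₁ := by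
    change J.pair a b (J.pair a b a (J.comp b a)) (J.comp b b) = A₁
    simp only [hA₁, JAlgebra.pair, meet_comp_conv ha]
  have hA' : (p (α * α) (p (α * β) β)).1 = J.conv A₁ := by
    change J.pair a b (J.comp a a) (J.pair a b (J.comp a b) b) = J.conv A₁
    simp only [hA₁, JAlgebra.pair, meet_comp_conv hb, J.convmeet, J.convcomp, J.convconv,
      J.cassoc, J.massoc]
  have hB : (p α (p (p (β * α) (β * (β * α))) (β * (β * β)))).1 = B₁ := by
    change J.pair a b a (J.pair a b (J.pair a b (J.comp b a) (J.comp b (J.comp b a)))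
      (J.comp b (J.comp b b))) = B₁
    simp only [hB₁, JAlgebra.pair, meet_comp_conv ha, meet_comp_conv hb, J.cassoc, J.massoc]
  have hB' : (p α (p (β * (α * α)) (p (β * (α * β)) (β * β)))).1 = J.conv B₁ := by
    change J.pair a b a (J.pair a b (J.comp b (J.comp a a))
      (J.pair a b (J.comp b (J.comp a b)) (J.comp b b))) = J.conv B₁
    simp only [hB₁, JAlgebra.pair, meet_comp_conv hb, J.convmeet, J.convcomp, J.convconv,
      J.cassoc, J.massoc]
  rw [← hA', ← hB', ← hA, ← hB]
  exact ⟨congrArg Subtype.val h.1, congrArg Subtype.val h.2⟩
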